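/- Entanglement swapping never increases fidelity: for all real F₁, F₂ with 1/4 ≤ F₁ ≤ 1 and 1/4 ≤ F₂ ≤ 1, one has S(F₁, F₂) ≤ min(F₁, F₂). -/

import Mathlib

/-- The entanglement swapping fidelity. -/
noncomputable def S (F₁ F₂ : ℝ) : ℝ :=
  1 / 4 + 3 / 4 * ((4 * F₁ - 1) / 3) * ((4 * F₂ - 1) / 3)

/-- Entanglement swapping never increases fidelity. -/
theorem swap_le_min (F₁ F₂ : ℝ) (h₁ : 1 / 4 ≤ F₁) (h₁' : F₁ ≤ 1)
    (h₂ : 1 / 4 ≤ F₂) (h₂' : F₂ ≤ 1) : S F₁ F₂ ≤ min F₁ F₂ := by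
  unfold S
  exact le_min
    (by nlinarith [mul_nonneg (sub_nonneg.2 h₁) (sub_nonneg.2 h₂')])
    (by nlinarith [mul_nonneg (sub_nonneg.2 h₂) (sub_nonneg.2 h₁')])
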